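/- arXiv:1511.09455 — 2 statements merged into one kernel-verified Lean document; each statement's English description precedes it below -/
import Mathlib

section
/- Let N(x,y) = Σ_{a,b≥0} N_{a,b} x^a y^b/(a! b!) in ℚ[[x,y]], where N_{a,b} is the number of non-ambiguous trees (over all nonempty binary tree shapes) with exactly a left children and b right children. Then N = (1 + ∫_x N) · (1 + ∫_y N), where ∫_x and ∫_y denote formal integration of power series. -/
inductive BT : Type where
  | nil : BT
  | node : BT → BT → BT
  deriving DecidableEq

namespace BT

/-- The list of positions (paths from the root, `false` = left step, `true` = right step)
of the vertices of a binary tree. -/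
def paths : BT → List (List Bool)
  | .nil => []
  | .node l r => [] :: (l.paths.map (List.cons false) ++ r.paths.map (List.cons true))

/-- Number of vertices. -/
def size (B : BT) : ℕ := B.paths.length

/-- The set of left children (positions ending with a left step). -/
def leftVertices (B : BT) : Finset (List Bool) :=
  B.paths.toFinset.filter (fun p => p.getLast? = some false)

/-- The set of right children (positions ending with a right step). -/
def rightVertices (B : BT) : Finset (List Bool) :=
  B.paths.toFinset.filter (fun p => p.getLast? = some true)

end BT

/-- A non-ambiguous tree of shape `B`: bijective labellings of the left (resp. right)
children by `Fin |LV B|` (resp. `Fin |RV B|`), decreasing along ancestry. -/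
structure NAT (B : BT) where
  fL : {p // p ∈ B.leftVertices} → Fin B.leftVertices.card
  fR : {p // p ∈ B.rightVertices} → Fin B.rightVertices.card
  bijL : Function.Bijective fL
  bijR : Function.Bijective fR
  ancL : ∀ u v : {p // p ∈ B.leftVertices}, u.1 <+: v.1 → u ≠ v → (fL v : ℕ) < fL u
  ancR : ∀ u v : {p // p ∈ B.rightVertices}, u.1 <+: v.1 → u ≠ v → (fR v : ℕ) < fR u

/-- `natCount a b`: the number of non-ambiguous trees (over all nonempty shapes)
with exactly `a` left children and `b` right children. -/
noncomputable def natCount (a b : ℕ) : ℕ :=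
  Nat.card {T : Σ B : BT, NAT B //
    T.1 ≠ BT.nil ∧ T.1.leftVertices.card = a ∧ T.1.rightVertices.card = b}

/-- The doubly exponential generating series `N(x,y) = Σ N_{a,b} x^a y^b/(a! b!)`. -/
noncomputable def natGF : MvPowerSeries (Fin 2) ℚ :=
  fun e => (natCount (e 0) (e 1) : ℚ) / ((e 0).factorial * (e 1).factorial)

/-- Formal integration with respect to `x` (the variable of index `0`). -/
noncomputable def intX (f : MvPowerSeries (Fin 2) ℚ) : MvPowerSeries (Fin 2) ℚ :=
  fun e => if e 0 = 0 then 0 else f (e - Finsupp.single 0 1) / (e 0 : ℚ)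

/-- Formal integration with respect to `y` (the variable of index `1`). -/
noncomputable def intY (f : MvPowerSeries (Fin 2) ℚ) : MvPowerSeries (Fin 2) ℚ :=
  fun e => if e 1 = 0 then 0 else f (e - Finsupp.single 1 1) / (e 1 : ℚ)

/-- The bijections `α ≃ T` which are strictly decreasing along the relation `r`. -/
def Labelling {α : Type} (r : α → α → Prop) (T : Type) [LT T] : Type :=
  {f : α ≃ T // ∀ u v, r u v → f v < f u}

namespace Labelling

variable {α β : Type}

instance (r : α → α → Prop) (T : Type) [LT T] [Finite T] : Finite (Labelling r T) := by
  by_cases h : Nonempty (α ≃ T)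
  · obtain ⟨e⟩ := h
    have : Finite α := Finite.of_equiv T e.symm
    exact inferInstanceAs (Finite {f : α ≃ T // ∀ u v, r u v → f v < f u})
  · have : IsEmpty (Labelling r T) := ⟨fun f => h ⟨f.1⟩⟩
    infer_instance

/-- The number of decreasing labellings of `r` by `0, …, |α| - 1`. -/
noncomputable def count (r : α → α → Prop) : ℕ :=
  Nat.card (Labelling r (Fin (Nat.card α)))

theorem card_congr_orderIso (r : α → α → Prop) {T U : Type} [LinearOrder T] [LinearOrder U]
    (e : T ≃o U) : Nat.card (Labelling r T) = Nat.card (Labelling r U) :=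
  Nat.card_congr
    { toFun := fun f => ⟨f.1.trans e.toEquiv, fun u v h => e.lt_iff_lt.2 (f.2 u v h)⟩
      invFun := fun f => ⟨f.1.trans e.symm.toEquiv, fun u v h => e.symm.lt_iff_lt.2 (f.2 u v h)⟩
      left_inv := fun _ => Subtype.ext (Equiv.ext fun _ => e.symm_apply_apply _)
      right_inv := fun _ => Subtype.ext (Equiv.ext fun _ => e.apply_symm_apply _) }

theorem card_eq_count (r : α → α → Prop) {T : Type} [LinearOrder T] [Finite T]
    (h : Nat.card T = Nat.card α) : Nat.card (Labelling r T) = count r := by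
  have := Fintype.ofFinite T
  rw [Nat.card_eq_fintype_card] at h
  exact (card_congr_orderIso r (Fintype.orderIsoFinOfCardEq T h)).symm

theorem card_eq_zero (r : α → α → Prop) {T : Type} [LinearOrder T]
    (h : Nat.card T ≠ Nat.card α) : Nat.card (Labelling r T) = 0 := by
  have : IsEmpty (Labelling r T) := ⟨fun f => h (Nat.card_congr f.1.symm)⟩
  exact Nat.card_of_isEmpty

theorem count_comap (s : β → β → Prop) (f : α → β) (hf : Function.Bijective f) :
    count (fun a b => s (f a) (f b)) = count s := by
  have hc : Nat.card α = Nat.card β := Nat.card_congr (Equiv.ofBijective f hf)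
  let e := Equiv.ofBijective f hf
  have he : ∀ b, f (e.symm b) = b := fun b => e.apply_symm_apply b
  rw [count, hc]
  refine Nat.card_congr
    { toFun := fun g => ⟨e.symm.trans g.1, fun u v h => g.2 _ _ (by simpa only [he] using h)⟩
      invFun := fun g => ⟨e.trans g.1, fun u v h => g.2 _ _ h⟩
      left_inv := fun g => Subtype.ext (Equiv.ext fun a => ?_)
      right_inv := fun g => Subtype.ext (Equiv.ext fun a => ?_) }
  · simp
  · simp

theorem count_of_isEmpty [IsEmpty α] (r : α → α → Prop) : count r = 1 := by
  have : IsEmpty (Fin (Nat.card α)) := by simp only [Nat.card_of_isEmpty]; infer_instance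
  have : Unique (Labelling r (Fin (Nat.card α))) :=
    { default := ⟨Equiv.equivOfIsEmpty _ _, fun u => isEmptyElim u⟩
      uniq := fun f => Subtype.ext (Equiv.ext fun a => isEmptyElim a) }
  exact Nat.card_unique

/-- Adding an element above all others does not change the number of labellings. -/
theorem count_option [Finite α] (r : Option α → Option α → Prop)
    (h₁ : ∀ a, r none (some a)) (h₂ : ∀ a, ¬ r a none) :
    count r = count (fun a b => r (some a) (some b)) := by
  set T := Fin (Nat.card (Option α))
  have hpos : Nat.card (Option α) = Nat.card α + 1 := Finite.card_option
  let t : T := ⟨Nat.card α, by omega⟩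
  have ht : ∀ x : T, x ≤ t := fun x => by
    have := x.2
    exact Fin.le_def.2 (by simp only [t]; omega)
  have htop : ∀ f : Labelling r T, f.1 none = t := fun f => by
    by_contra hne
    rcases hx : f.1.symm t with _ | a
    · exact hne (by rw [← hx, Equiv.apply_symm_apply])
    · have h := f.2 _ _ (h₁ a)
      rw [← hx, Equiv.apply_symm_apply] at h
      exact absurd h (not_lt.2 (ht _))
  have hcard : Nat.card {y : T // y ≠ t} = Nat.card α := by
    rw [Nat.card_eq_fintype_card, Fintype.card_subtype_compl, Fintype.card_subtype_eq,
      ← Nat.card_eq_fintype_card, Nat.card_fin, hpos, Nat.add_sub_cancel]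
  rw [← card_eq_count (fun a b => r (some a) (some b)) hcard]
  refine Nat.card_congr
    { toFun := fun f => ⟨Equiv.optionSubtype t ⟨f.1, htop f⟩, fun u v h => ?_⟩
      invFun := fun g => ⟨((Equiv.optionSubtype t).symm g.1).1, ?_⟩
      left_inv := fun f => Subtype.ext (by simp)
      right_inv := fun g => Subtype.ext (by simp) }
  · rw [← Subtype.coe_lt_coe]
    simpa using f.2 _ _ h
  · rintro (_ | u) (_ | v) h
    · exact absurd h (h₂ _)
    · have h3 := (g.1 v).2
      simpa using lt_of_le_of_ne (ht _) h3
    · exact absurd h (h₂ _)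
    · simpa using g.2 _ _ h

/-- The labellings of a sum for which `s` is the set of labels of the left summand. -/
noncomputable def sumFiberEquiv (r : α ⊕ β → α ⊕ β → Prop) (h₁ : ∀ a b, ¬ r (.inl a) (.inr b))
    (h₂ : ∀ a b, ¬ r (.inr b) (.inl a)) {T : Type} [LinearOrder T] (s : Finset T) :
    {f : Labelling r T // ∀ x, x ∈ s ↔ (f.1.symm x).isLeft} ≃
      Labelling (fun a b => r (.inl a) (.inl b)) {x // x ∈ s} ×
        Labelling (fun a b => r (.inr a) (.inr b)) {x // x ∉ s} where
  toFun f :=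
    ⟨⟨Equiv.ofBijective (fun a => ⟨f.1.1 (.inl a), (f.2 _).2 (by simp)⟩)
        ⟨fun a b h => Sum.inl_injective (f.1.1.injective (congrArg Subtype.val h)), fun x => by
          obtain ⟨a, ha⟩ := Sum.isLeft_iff.1 ((f.2 _).1 x.2)
          exact ⟨a, Subtype.ext (by simp [← ha])⟩⟩, fun u v h => f.1.2 _ _ h⟩,
      ⟨Equiv.ofBijective (fun a => ⟨f.1.1 (.inr a), fun h => by simpa using (f.2 _).1 h⟩)
        ⟨fun a b h => Sum.inr_injective (f.1.1.injective (congrArg Subtype.val h)), fun x => by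
          have hx := mt (f.2 _).2 x.2
          rw [Sum.not_isLeft, Sum.isRight_iff] at hx
          obtain ⟨a, ha⟩ := hx
          exact ⟨a, Subtype.ext (by simp [← ha])⟩⟩, fun u v h => f.1.2 _ _ h⟩⟩
  invFun g :=
    ⟨⟨(Equiv.sumCongr g.1.1 g.2.1).trans (Equiv.sumCompl (· ∈ s)), by
      rintro (u | u) (v | v) h
      · exact g.1.2 _ _ h
      · exact absurd h (h₁ _ _)
      · exact absurd h (h₂ _ _)
      · exact g.2.2 _ _ h⟩, fun x => by
        by_cases hx : x ∈ s <;>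
          simp [hx, Equiv.sumCompl_symm_apply_of_pos, Equiv.sumCompl_symm_apply_of_neg]⟩
  left_inv f := Subtype.ext (Subtype.ext (Equiv.ext fun a => by cases a <;> rfl))
  right_inv g := Prod.ext (Subtype.ext (Equiv.ext fun a => Subtype.ext rfl))
    (Subtype.ext (Equiv.ext fun a => Subtype.ext rfl))

/-- The labellings of a disjoint sum are the shuffles of the labellings of the summands. -/
theorem count_sum [Finite α] [Finite β] (r : α ⊕ β → α ⊕ β → Prop)
    (h₁ : ∀ a b, ¬ r (.inl a) (.inr b)) (h₂ : ∀ a b, ¬ r (.inr b) (.inl a)) :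
    count r = (Nat.card α + Nat.card β).choose (Nat.card α) *
      (count (fun a b => r (.inl a) (.inl b)) * count (fun a b => r (.inr a) (.inr b))) := by
  have hc : Nat.card (α ⊕ β) = Nat.card α + Nat.card β := Nat.card_sum
  rw [count, hc]
  set T := Fin (Nat.card α + Nat.card β)
  let F : Labelling r T → Finset T := fun f => Finset.univ.filter fun x => (f.1.symm x).isLeft
  have hF : ∀ s f, F f = s ↔ ∀ x, x ∈ s ↔ (f.1.symm x).isLeft := fun s f => by
    simp only [F, Finset.ext_iff, Finset.mem_filter, Finset.mem_univ, true_and]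
    exact forall_congr' fun x => Iff.comm
  rw [← Nat.card_congr (Equiv.sigmaFiberEquiv F), Nat.card_sigma]
  have hs : ∀ s : Finset T, Nat.card {f // F f = s} = if s ∈ Finset.univ.powersetCard (Nat.card α)
      then count (fun a b => r (.inl a) (.inl b)) * count (fun a b => r (.inr a) (.inr b))
      else 0 := fun s => by
    rw [Nat.card_congr ((Equiv.subtypeEquivRight (hF s)).trans (sumFiberEquiv r h₁ h₂ s)),
      Nat.card_prod]
    have hs1 : Nat.card {x // x ∈ s} = s.card := by simp
    have hs2 : Nat.card {x // x ∉ s} = Nat.card α + Nat.card β - s.card := by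
      rw [Nat.card_eq_fintype_card, Fintype.card_subtype_compl]
      simp [T]
    split_ifs with h
    · rw [Finset.mem_powersetCard] at h
      rw [card_eq_count _ (hs1.trans h.2), card_eq_count _ (by omega)]
    · rw [card_eq_zero, zero_mul]
      rw [hs1]
      simpa using h
  rw [Finset.sum_congr rfl fun s _ => hs s, ← Finset.sum_filter, Finset.sum_const, smul_eq_mul,
    Finset.filter_mem_eq_inter, Finset.univ_inter, Finset.card_powersetCard, Finset.card_univ,
    Fintype.card_fin]

end Labelling

/-- Strict ancestry on a set of positions. -/
def StrictAncestor (S : Finset (List Bool)) (u v : {p // p ∈ S}) : Prop :=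
  u.1 <+: v.1 ∧ u ≠ v

theorem strictAncestor_iff {S : Finset (List Bool)} {u v : {p // p ∈ S}} :
    StrictAncestor S u v ↔ u.1 <+: v.1 ∧ u.1 ≠ v.1 :=
  and_congr_right fun _ => not_congr Subtype.ext_iff

/-- The proportion of the bijective labellings of `S` which decrease along ancestry. -/
noncomputable def weight (S : Finset (List Bool)) : ℚ :=
  (Labelling.count (StrictAncestor S) : ℚ) / S.card.factorial

theorem weight_empty : weight ∅ = 1 := by
  have : IsEmpty {p : List Bool // p ∈ (∅ : Finset (List Bool))} := ⟨fun p => Finset.notMem_empty _ p.2⟩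
  simp [weight, Labelling.count_of_isEmpty]

theorem weight_image_cons (c : Bool) (S : Finset (List Bool)) :
    weight (S.image (List.cons c)) = weight S := by
  have hinj : Function.Injective (List.cons c) := List.cons_injective
  let φ : {p // p ∈ S} → {p // p ∈ S.image (List.cons c)} :=
    fun p => ⟨c :: p.1, Finset.mem_image_of_mem _ p.2⟩
  have hφ : Function.Bijective φ := by
    refine ⟨fun p q h => Subtype.ext (hinj (congrArg Subtype.val h)), fun ⟨q, hq⟩ => ?_⟩
    obtain ⟨p, hp, rfl⟩ := Finset.mem_image.1 hq
    exact ⟨⟨p, hp⟩, rfl⟩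
  have hr : StrictAncestor S =
      fun p q => StrictAncestor (S.image (List.cons c)) (φ p) (φ q) := by
    funext p q
    simp [strictAncestor_iff, φ, List.cons_prefix_cons]
  rw [weight, weight, Finset.card_image_of_injective _ hinj, hr, Labelling.count_comap _ φ hφ]

theorem weight_insert_nil {S : Finset (List Bool)} (hS : [] ∉ S) :
    weight (insert [] S) = weight S / (S.card + 1) := by
  let φ : Option {p // p ∈ S} → {p // p ∈ insert [] S} := fun o =>
    o.elim ⟨[], Finset.mem_insert_self _ _⟩ fun p => ⟨p.1, Finset.mem_insert_of_mem p.2⟩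
  have hφ : Function.Bijective φ := by
    constructor
    · rintro (_ | ⟨p, hp⟩) (_ | ⟨q, hq⟩) h
      · rfl
      · have h' : [] = q := congrArg Subtype.val h
        exact absurd (h' ▸ hq) hS
      · have h' : p = [] := congrArg Subtype.val h
        exact absurd (h' ▸ hp) hS
      · exact congrArg some (Subtype.ext (congrArg Subtype.val h : p = q))
    · rintro ⟨q, hq⟩
      rcases Finset.mem_insert.1 hq with rfl | h
      · exact ⟨none, rfl⟩
      · exact ⟨some ⟨q, h⟩, rfl⟩
  have hcount : Labelling.count (StrictAncestor (insert [] S)) =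
      Labelling.count (StrictAncestor S) := by
    rw [← Labelling.count_comap _ φ hφ, Labelling.count_option]
    · congr 1
      funext p q
      simp [strictAncestor_iff, φ]
    · rintro ⟨p, hp⟩
      refine ⟨List.nil_prefix, fun h => hS ?_⟩
      have h' : [] = p := congrArg Subtype.val h
      exact h' ▸ hp
    · rintro a ⟨h₁, h₂⟩
      exact h₂ (Subtype.ext (List.prefix_nil.1 h₁))
  rw [weight, weight, hcount, Finset.card_insert_of_notMem hS, Nat.factorial_succ]
  push_cast
  rw [div_div, mul_comm]

theorem weight_union {S T : Finset (List Bool)}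
    (hST : ∀ p ∈ S, ∀ q ∈ T, ¬ p <+: q ∧ ¬ q <+: p) :
    weight (S ∪ T) = weight S * weight T := by
  have hd : Disjoint S T := Finset.disjoint_left.2 fun p hp hq =>
    (hST p hp p hq).1 (List.prefix_refl p)
  let φ : {p // p ∈ S} ⊕ {p // p ∈ T} → {p // p ∈ S ∪ T} :=
    Sum.elim (fun p => ⟨p.1, Finset.mem_union_left _ p.2⟩)
      fun p => ⟨p.1, Finset.mem_union_right _ p.2⟩
  have hφ : Function.Bijective φ := by
    constructor
    · rintro (⟨p, hp⟩ | ⟨p, hp⟩) (⟨q, hq⟩ | ⟨q, hq⟩) h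
      all_goals
        have h' : p = q := congrArg Subtype.val h
        subst h'
      · rfl
      · exact absurd hq (Finset.disjoint_left.1 hd hp)
      · exact absurd hp (Finset.disjoint_left.1 hd hq)
      · rfl
    · rintro ⟨q, hq⟩
      rcases Finset.mem_union.1 hq with h | h
      · exact ⟨.inl ⟨q, h⟩, rfl⟩
      · exact ⟨.inr ⟨q, h⟩, rfl⟩
  have hcount : Labelling.count (StrictAncestor (S ∪ T)) = (S.card + T.card).choose S.card *
      (Labelling.count (StrictAncestor S) * Labelling.count (StrictAncestor T)) := by
    rw [← Labelling.count_comap _ φ hφ, Labelling.count_sum]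
    · congr 2
      · simp
      · simp
      · congr 1
        funext p q
        simp [strictAncestor_iff, φ]
      · congr 1
        funext p q
        simp [strictAncestor_iff, φ]
    · exact fun a b h => (hST _ a.2 _ b.2).1 h.1
    · exact fun a b h => (hST _ a.2 _ b.2).2 h.1
  rw [weight, weight, weight, hcount, Finset.card_union_of_disjoint hd,
    ← Nat.add_choose_mul_factorial_mul_factorial]
  have h : ((S.card + T.card).choose S.card : ℚ) ≠ 0 :=
    Nat.cast_ne_zero.2 (Nat.choose_pos (Nat.le_add_right _ _)).ne'
  rw [← Nat.choose_symm_add]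
  push_cast
  field_simp

namespace BT

/-- The positions ending with the step `b`: the left (resp. right) children. -/
def vertices (b : Bool) (B : BT) : Finset (List Bool) :=
  B.paths.toFinset.filter fun p => p.getLast? = some b

/-- The vertices of `B` which end with the step `b` once `B` is grafted as a
left (`c = false`) or right (`c = true`) subtree. -/
def graftedVertices (c b : Bool) (B : BT) : Finset (List Bool) :=
  B.paths.toFinset.filter fun p => (c :: p).getLast? = some b

theorem nil_mem_paths {B : BT} (hB : B ≠ nil) : [] ∈ B.paths := by
  cases B with
  | nil => exact absurd rfl hB
  | node l r => simp [paths]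

theorem vertices_node (b : Bool) (l r : BT) :
    (node l r).vertices b =
      (l.graftedVertices false b).image (List.cons false) ∪
        (r.graftedVertices true b).image (List.cons true) := by
  ext p
  simp only [vertices, graftedVertices, paths, Finset.mem_filter, Finset.mem_union,
    Finset.mem_image, List.mem_toFinset, List.mem_cons, List.mem_append, List.mem_map]
  constructor
  · rintro ⟨rfl | ⟨q, hq, rfl⟩ | ⟨q, hq, rfl⟩, h⟩
    · simp at h
    · exact .inl ⟨q, ⟨hq, h⟩, rfl⟩
    · exact .inr ⟨q, ⟨hq, h⟩, rfl⟩
  · rintro (⟨q, ⟨hq, h⟩, rfl⟩ | ⟨q, ⟨hq, h⟩, rfl⟩)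
    · exact ⟨.inr (.inl ⟨q, hq, rfl⟩), h⟩
    · exact ⟨.inr (.inr ⟨q, hq, rfl⟩), h⟩

theorem nil_notMem_vertices (b : Bool) (B : BT) : [] ∉ B.vertices b := by
  simp [vertices]

theorem graftedVertices_nil (c b : Bool) : nil.graftedVertices c b = ∅ := by
  simp [graftedVertices, paths]

theorem graftedVertices_self (c : Bool) {B : BT} (hB : B ≠ nil) :
    B.graftedVertices c c = insert [] (B.vertices c) := by
  ext p
  cases p with
  | nil => simp [graftedVertices, nil_mem_paths hB]
  | cons d p => simp [graftedVertices, vertices, List.getLast?_cons_cons]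

theorem graftedVertices_of_ne {c b : Bool} (h : c ≠ b) (B : BT) :
    B.graftedVertices c b = B.vertices b := by
  ext p
  cases p with
  | nil => simp [graftedVertices, vertices, h]
  | cons d p => simp [graftedVertices, vertices, List.getLast?_cons_cons]

theorem card_vertices_node (b : Bool) (l r : BT) :
    ((node l r).vertices b).card =
      (l.graftedVertices false b).card + (r.graftedVertices true b).card := by
  rw [vertices_node, Finset.card_union_of_disjoint, Finset.card_image_of_injective _
    List.cons_injective, Finset.card_image_of_injective _ List.cons_injective]
  rw [Finset.disjoint_left]
  intro p hp hq
  obtain ⟨p, -, rfl⟩ := Finset.mem_image.1 hp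
  obtain ⟨q, -, h⟩ := Finset.mem_image.1 hq
  simp at h

theorem weight_vertices_node (b : Bool) (l r : BT) :
    weight ((node l r).vertices b) =
      weight (l.graftedVertices false b) * weight (r.graftedVertices true b) := by
  rw [vertices_node, weight_union, weight_image_cons, weight_image_cons]
  intro p hp q hq
  obtain ⟨p, -, rfl⟩ := Finset.mem_image.1 hp
  obtain ⟨q, -, rfl⟩ := Finset.mem_image.1 hq
  simp [List.cons_prefix_cons]

theorem card_graftedVertices_self (c : Bool) {B : BT} (hB : B ≠ nil) :
    (B.graftedVertices c c).card = (B.vertices c).card + 1 := by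
  rw [graftedVertices_self c hB, Finset.card_insert_of_notMem (nil_notMem_vertices c B)]

theorem weight_graftedVertices_self (c : Bool) {B : BT} (hB : B ≠ nil) :
    weight (B.graftedVertices c c) = weight (B.vertices c) / ((B.vertices c).card + 1) := by
  rw [graftedVertices_self c hB, weight_insert_nil (nil_notMem_vertices c B)]

theorem card_paths_le (B : BT) :
    B.paths.toFinset.card ≤ (B.vertices false).card + (B.vertices true).card + 1 := by
  have h : B.paths.toFinset ⊆ insert [] (B.vertices false ∪ B.vertices true) := fun p hp => by
    rcases hl : p.getLast? with _ | b
    · simp [List.getLast?_eq_none_iff.1 hl]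
    · cases b <;> simp_all [vertices]
  refine (Finset.card_le_card h).trans ((Finset.card_insert_le _ _).trans ?_)
  exact Nat.succ_le_succ (Finset.card_union_le _ _)

theorem finite_card_paths_le (n : ℕ) : {B : BT | B.paths.toFinset.card ≤ n}.Finite := by
  induction n with
  | zero =>
    refine (Set.finite_singleton nil).subset fun B hB => ?_
    by_contra h
    have := nil_mem_paths h
    simp_all
  | succ n ih =>
    refine ((ih.image2 node ih).insert nil).subset fun B hB => ?_
    cases B with
    | nil => exact Set.mem_insert _ _
    | node l r =>
      have key : ∀ (c : Bool) (D : BT),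
          (∀ p ∈ D.paths, c :: p ∈ (node l r).paths) → D.paths.toFinset.card ≤ n := by
        intro c D hD
        have hsub : insert [] (D.paths.toFinset.image (List.cons c)) ⊆
            (node l r).paths.toFinset := by
          intro p hp
          rw [Finset.mem_insert, Finset.mem_image] at hp
          rcases hp with rfl | ⟨q, hq, rfl⟩
          · simp [paths]
          · exact List.mem_toFinset.2 (hD q (List.mem_toFinset.1 hq))
        have h := (Finset.card_le_card hsub).trans hB
        rw [Finset.card_insert_of_notMem (by simp),
          Finset.card_image_of_injective _ List.cons_injective] at h
        omega
      refine .inr ⟨l, key false l ?_, r, key true r ?_, rfl⟩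
      · intro p hp
        simp [paths, hp]
      · intro p hp
        simp [paths, hp]

/-- The nonempty shapes with `e 0` left children and `e 1` right children. -/
def shapes (e : Fin 2 →₀ ℕ) : Set BT :=
  {B | B ≠ nil ∧ (B.vertices false).card = e 0 ∧ (B.vertices true).card = e 1}

/-- The shapes contributing `e 0` left children and `e 1` right children when grafted
on the side `c`. -/
def graftedShapes (c : Bool) (e : Fin 2 →₀ ℕ) : Set BT :=
  {B | (B.graftedVertices c false).card = e 0 ∧ (B.graftedVertices c true).card = e 1}

theorem finite_shapes (e : Fin 2 →₀ ℕ) : (shapes e).Finite := by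
  refine (finite_card_paths_le (e 0 + e 1 + 1)).subset fun B hB => ?_
  have h := B.card_paths_le
  rwa [hB.2.1, hB.2.2] at h

theorem card_vertices_le (c b : Bool) (B : BT) :
    (B.vertices b).card ≤ (B.graftedVertices c b).card := by
  refine Finset.card_le_card fun p hp => ?_
  cases p with
  | nil => exact absurd hp (nil_notMem_vertices b B)
  | cons d p => simpa [graftedVertices, vertices, List.getLast?_cons_cons] using hp

theorem finite_graftedShapes (c : Bool) (e : Fin 2 →₀ ℕ) : (graftedShapes c e).Finite := by
  refine (finite_card_paths_le (e 0 + e 1 + 1)).subset fun B hB => ?_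
  have h := B.card_paths_le
  have h₁ := B.card_vertices_le c false
  have h₂ := B.card_vertices_le c true
  rw [hB.1] at h₁
  rw [hB.2] at h₂
  simp only [Set.mem_ofPred_eq]
  omega

/-- The generating series of grafted subtrees on the side `c`. -/
noncomputable def graftedGF (c : Bool) : MvPowerSeries (Fin 2) ℚ := fun e =>
  ∑ B ∈ (finite_graftedShapes c e).toFinset,
    weight (B.graftedVertices c false) * weight (B.graftedVertices c true)

end BT

/-- A non-ambiguous tree is a pair of decreasing labellings. -/
noncomputable def NAT.equivLabelling (B : BT) :
    NAT B ≃ Labelling (StrictAncestor B.leftVertices) (Fin B.leftVertices.card) ×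
      Labelling (StrictAncestor B.rightVertices) (Fin B.rightVertices.card) where
  toFun N := ⟨⟨Equiv.ofBijective N.fL N.bijL, fun u v h => N.ancL u v h.1 h.2⟩,
    ⟨Equiv.ofBijective N.fR N.bijR, fun u v h => N.ancR u v h.1 h.2⟩⟩
  invFun L := ⟨L.1.1, L.2.1, L.1.1.bijective, L.2.1.bijective,
    fun u v h h' => L.1.2 u v ⟨h, h'⟩, fun u v h h' => L.2.2 u v ⟨h, h'⟩⟩
  left_inv _ := rfl
  right_inv _ := Prod.ext (Subtype.ext (Equiv.ext fun _ => rfl))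
    (Subtype.ext (Equiv.ext fun _ => rfl))

instance (B : BT) : Finite (NAT B) := Finite.of_equiv _ (NAT.equivLabelling B).symm

theorem NAT.card_div (B : BT) :
    (Nat.card (NAT B) : ℚ) / ((B.vertices false).card.factorial *
      (B.vertices true).card.factorial) =
      weight (B.vertices false) * weight (B.vertices true) := by
  rw [Nat.card_congr (NAT.equivLabelling B), Nat.card_prod,
    Labelling.card_eq_count _ (by simp), Labelling.card_eq_count _ (by simp), Nat.cast_mul,
    mul_div_mul_comm]
  rfl

theorem natGF_apply (e : Fin 2 →₀ ℕ) :
    natGF e = ∑ B ∈ (BT.finite_shapes e).toFinset,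
      weight (B.vertices false) * weight (B.vertices true) := by
  have hfin := BT.finite_shapes e
  have := hfin.fintype
  have hcard : natCount (e 0) (e 1) = ∑ B ∈ hfin.toFinset, Nat.card (NAT B) := by
    let φ : {T : Σ B : BT, NAT B // T.1 ≠ BT.nil ∧ T.1.leftVertices.card = e 0 ∧
        T.1.rightVertices.card = e 1} ≃ Σ B : BT.shapes e, NAT B.1 :=
      { toFun := fun T => ⟨⟨T.1.1, T.2⟩, T.1.2⟩
        invFun := fun T => ⟨⟨T.1.1, T.2⟩, T.1.2⟩
        left_inv := fun _ => rfl
        right_inv := fun _ => rfl }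
    rw [natCount, Nat.card_congr φ, Nat.card_sigma]
    exact (Finset.sum_subtype _ (fun B => hfin.mem_toFinset) fun B => Nat.card (NAT B)).symm
  rw [natGF, hcard, Nat.cast_sum, Finset.sum_div]
  refine Finset.sum_congr rfl fun B hB => ?_
  obtain ⟨-, h₀, h₁⟩ := hfin.mem_toFinset.1 hB
  rw [← NAT.card_div, h₀, h₁]

theorem natGF_eq_mul_graftedGF : natGF = BT.graftedGF false * BT.graftedGF true := by
  ext e
  rw [MvPowerSeries.coeff_mul]
  change natGF e = ∑ d ∈ Finset.HasAntidiagonal.antidiagonal e, BT.graftedGF false d.1 * BT.graftedGF true d.2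
  rw [natGF_apply]
  simp only [BT.graftedGF, Finset.sum_mul_sum, ← Finset.sum_product']
  rw [Finset.sum_sigma']
  symm
  refine Finset.sum_bij (fun x _ => BT.node x.2.1 x.2.2) ?_ ?_ ?_ ?_
  · rintro ⟨⟨d₁, d₂⟩, l, r⟩ hx
    simp only [Finset.mem_sigma, Finset.HasAntidiagonal.mem_antidiagonal, Finset.mem_product,
      Set.Finite.mem_toFinset, BT.graftedShapes, Set.mem_ofPred_eq] at hx
    obtain ⟨rfl, hl, hr⟩ := hx
    simp [BT.shapes, BT.card_vertices_node, hl, hr]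
  · rintro ⟨⟨d₁, d₂⟩, l, r⟩ hx ⟨⟨d₁', d₂'⟩, l', r'⟩ hx' h
    simp only [Finset.mem_sigma, Finset.HasAntidiagonal.mem_antidiagonal, Finset.mem_product,
      Set.Finite.mem_toFinset, BT.graftedShapes, Set.mem_ofPred_eq] at hx hx'
    obtain ⟨rfl, rfl⟩ := BT.node.inj h
    have h₁ : d₁ = d₁' := by
      ext i
      fin_cases i
      · exact hx.2.1.1.symm.trans hx'.2.1.1
      · exact hx.2.1.2.symm.trans hx'.2.1.2
    have h₂ : d₂ = d₂' := by
      ext i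
      fin_cases i
      · exact hx.2.2.1.symm.trans hx'.2.2.1
      · exact hx.2.2.2.symm.trans hx'.2.2.2
    rw [h₁, h₂]
  · intro B hB
    obtain ⟨hne, h₀, h₁⟩ := (BT.finite_shapes e).mem_toFinset.1 hB
    cases B with
    | nil => exact absurd rfl hne
    | node l r =>
      rw [BT.card_vertices_node] at h₀ h₁
      refine ⟨⟨⟨Finsupp.equivFunOnFinite.symm
          ![(l.graftedVertices false false).card, (l.graftedVertices false true).card],
        Finsupp.equivFunOnFinite.symm
          ![(r.graftedVertices true false).card, (r.graftedVertices true true).card]⟩, l, r⟩,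
        ?_, rfl⟩
      simp only [Finset.mem_sigma, Finset.HasAntidiagonal.mem_antidiagonal, Finset.mem_product,
        Set.Finite.mem_toFinset, BT.graftedShapes, Set.mem_ofPred_eq]
      refine ⟨?_, ⟨rfl, rfl⟩, rfl, rfl⟩
      ext i
      fin_cases i
      · exact h₀
      · exact h₁
  · rintro ⟨⟨d₁, d₂⟩, l, r⟩ -
    rw [BT.weight_vertices_node, BT.weight_vertices_node, mul_mul_mul_comm]

theorem one_apply_eq (e : Fin 2 →₀ ℕ) :
    (1 : MvPowerSeries (Fin 2) ℚ) e = if e 0 = 0 ∧ e 1 = 0 then 1 else 0 := by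
  classical
  have h : e = 0 ↔ e 0 = 0 ∧ e 1 = 0 := by
    simp [Finsupp.ext_iff, Fin.forall_fin_two]
  have := MvPowerSeries.coeff_one (R := ℚ) (n := e)
  simp only [h] at this
  exact this

theorem graftedGF_false : BT.graftedGF false = 1 + intX natGF := by
  ext e
  change BT.graftedGF false e = (1 : MvPowerSeries (Fin 2) ℚ) e + intX natGF e
  rw [one_apply_eq, intX, BT.graftedGF]
  by_cases h0 : e 0 = 0
  · rw [if_pos h0, add_zero]
    have hnil : ∀ B ∈ BT.graftedShapes false e, B = BT.nil := fun B hB => by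
      by_contra hne
      have := hB.1
      rw [BT.card_graftedVertices_self _ hne] at this
      omega
    by_cases h1 : e 1 = 0
    · have hs : (BT.finite_graftedShapes false e).toFinset = {BT.nil} := by
        ext B
        rw [Set.Finite.mem_toFinset, Finset.mem_singleton]
        refine ⟨hnil B, ?_⟩
        rintro rfl
        simp [BT.graftedShapes, BT.graftedVertices_nil, h0, h1]
      rw [if_pos ⟨h0, h1⟩, hs]
      simp [BT.graftedVertices_nil, weight_empty]
    · rw [if_neg (fun h => h1 h.2)]
      refine Finset.sum_eq_zero fun B hB => ?_
      rw [Set.Finite.mem_toFinset] at hB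
      have h := hB.2
      rw [hnil B hB, BT.graftedVertices_nil] at h
      exact absurd h.symm h1
  · rw [if_neg h0, if_neg (fun h => h0 h.1), zero_add, natGF_apply, Finset.sum_div]
    have hs : ∀ B, B ∈ BT.graftedShapes false e ↔
        B ∈ BT.shapes (e - Finsupp.single 0 1) := fun B => by
      by_cases hB : B = BT.nil
      · subst hB
        simp [BT.graftedShapes, BT.shapes, BT.graftedVertices_nil, Ne.symm h0]
      · simp only [BT.graftedShapes, BT.shapes, Set.mem_ofPred_eq,
          BT.card_graftedVertices_self _ hB, BT.graftedVertices_of_ne Bool.false_ne_true]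
        simp [hB]
        omega
    refine Finset.sum_congr (by ext B; simpa using hs B) fun B hB => ?_
    rw [Set.Finite.mem_toFinset] at hB
    have hc := ((hs B).2 hB).1
    rw [BT.card_graftedVertices_self _ hB.1] at hc
    rw [BT.weight_graftedVertices_self _ hB.1, BT.graftedVertices_of_ne Bool.false_ne_true, ← hc,
      div_mul_eq_mul_div]
    push_cast
    rfl

theorem graftedGF_true : BT.graftedGF true = 1 + intY natGF := by
  ext e
  change BT.graftedGF true e = (1 : MvPowerSeries (Fin 2) ℚ) e + intY natGF e
  rw [one_apply_eq, intY, BT.graftedGF]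
  by_cases h1 : e 1 = 0
  · rw [if_pos h1, add_zero]
    have hnil : ∀ B ∈ BT.graftedShapes true e, B = BT.nil := fun B hB => by
      by_contra hne
      have := hB.2
      rw [BT.card_graftedVertices_self _ hne] at this
      omega
    by_cases h0 : e 0 = 0
    · have hs : (BT.finite_graftedShapes true e).toFinset = {BT.nil} := by
        ext B
        rw [Set.Finite.mem_toFinset, Finset.mem_singleton]
        refine ⟨hnil B, ?_⟩
        rintro rfl
        simp [BT.graftedShapes, BT.graftedVertices_nil, h0, h1]
      rw [if_pos ⟨h0, h1⟩, hs]
      simp [BT.graftedVertices_nil, weight_empty]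
    · rw [if_neg (fun h => h0 h.1)]
      refine Finset.sum_eq_zero fun B hB => ?_
      rw [Set.Finite.mem_toFinset] at hB
      have h := hB.1
      rw [hnil B hB, BT.graftedVertices_nil] at h
      exact absurd h.symm h0
  · rw [if_neg h1, if_neg (fun h => h1 h.2), zero_add, natGF_apply, Finset.sum_div]
    have hs : ∀ B, B ∈ BT.graftedShapes true e ↔
        B ∈ BT.shapes (e - Finsupp.single 1 1) := fun B => by
      by_cases hB : B = BT.nil
      · subst hB
        simp [BT.graftedShapes, BT.shapes, BT.graftedVertices_nil, Ne.symm h1]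
      · simp only [BT.graftedShapes, BT.shapes, Set.mem_ofPred_eq,
          BT.card_graftedVertices_self _ hB, BT.graftedVertices_of_ne Bool.false_ne_true.symm]
        simp [hB]
        omega
    refine Finset.sum_congr (by ext B; simpa using hs B) fun B hB => ?_
    rw [Set.Finite.mem_toFinset] at hB
    have hc := ((hs B).2 hB).2
    rw [BT.card_graftedVertices_self _ hB.1] at hc
    rw [BT.weight_graftedVertices_self _ hB.1, BT.graftedVertices_of_ne Bool.false_ne_true.symm,
      ← hc, mul_div_assoc]
    push_cast
    rfl

/-- `N = (1 + ∫ₓ N) · (1 + ∫_y N)`. -/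
theorem natGF_eq : natGF = (1 + intX natGF) * (1 + intY natGF) := by
  rw [← graftedGF_false, ← graftedGF_true]
  exact natGF_eq_mul_graftedGF
end

section
/- Let N(x,y) = Σ_{a,b≥0} N_{a,b} x^a y^b/(a! b!) in ℚ[[x,y]], where N_{a,b} is the number of non-ambiguous trees (over all nonempty binary tree shapes) with exactly a left children and b right children. Then N(x,y) · (1 − (e^x − 1)(e^y − 1))^2 = e^{x+y}, where e^x, e^y, e^{x+y} denote the formal exponential power series; equivalently, N = e^{x+y}/(1 − (e^x−1)(e^y−1))^2. -/
/-- The formal exponential series `e^{c₀ x + c₁ y} = Σ c₀^a c₁^b x^a y^b/(a! b!)`. -/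
noncomputable def expXY (c₀ c₁ : ℚ) : MvPowerSeries (Fin 2) ℚ :=
  fun e => c₀ ^ (e 0) * c₁ ^ (e 1) / ((e 0).factorial * (e 1).factorial)

/-- Bijective labellings of `X` by `Fin n` that are strictly decreasing along `r`. -/
abbrev DecLabelling {X : Type*} (n : ℕ) (r : X → X → Prop) : Type _ :=
  {f : X ≃ Fin n // ∀ u v, r u v → f v < f u}

namespace DecLabelling

variable {X Y : Type*} {n m : ℕ}

theorem card_congr {r : X → X → Prop} {s : Y → Y → Prop} (e : X ≃ Y)
    (h : ∀ u v, s (e u) (e v) ↔ r u v) :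
    Nat.card (DecLabelling n r) = Nat.card (DecLabelling n s) := by
  refine Nat.card_congr (Equiv.subtypeEquiv (Equiv.equivCongr e (Equiv.refl _)) fun f => ?_)
  constructor
  · intro hf u v huv
    have := hf (e.symm u) (e.symm v) (by rw [← h]; simpa using huv)
    simpa using this
  · intro hf u v huv
    simpa using hf (e u) (e v) ((h u v).2 huv)

/-- Along any injective map to a linear order, the number of rearrangements that are decreasing
is the number of decreasing labellings. -/
theorem card_perm_comp {α : Type*} [LinearOrder α] (r : X → X → Prop) (e₀ : X ≃ Fin n)
    (g : X → α) (hg : Function.Injective g) :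
    Nat.card {σ : Equiv.Perm X // ∀ u v, r u v → g (σ v) < g (σ u)}
      = Nat.card (DecLabelling n r) := by
  let _ : Fintype X := Fintype.ofEquiv _ e₀.symm
  let _ : LinearOrder X := LinearOrder.lift' g hg
  have hc : Fintype.card X = n := by simpa using Fintype.card_congr e₀
  let e : X ≃o Fin n := (Fintype.orderIsoFinOfCardEq X hc).symm
  refine Nat.card_congr (Equiv.subtypeEquiv
    (Equiv.equivCongr (Equiv.refl X) e.toEquiv) fun σ => ?_)
  refine forall₃_congr fun u v _ => ?_
  have : g (σ v) < g (σ u) ↔ σ v < σ u := Iff.rfl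
  rw [this]
  simp

theorem card_sum (r : X → X → Prop) (s : Y → Y → Prop) (eX : X ≃ Fin n) (eY : Y ≃ Fin m) :
    (n.factorial * m.factorial) * Nat.card (DecLabelling (n + m) (Sum.LiftRel r s))
      = (n + m).factorial * (Nat.card (DecLabelling n r) * Nat.card (DecLabelling m s)) := by
  classical
  let _ : Fintype X := Fintype.ofEquiv _ eX.symm
  let _ : Fintype Y := Fintype.ofEquiv _ eY.symm
  let eXY : X ⊕ Y ≃ Fin (n + m) := (Equiv.sumCongr eX eY).trans finSumFinEquiv
  let R : (X ⊕ Y ≃ Fin (n + m)) → Equiv.Perm X × Equiv.Perm Y → Prop := fun g p =>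
    (∀ u v, r u v → g (.inl (p.1 v)) < g (.inl (p.1 u))) ∧
      ∀ u v, s u v → g (.inr (p.2 v)) < g (.inr (p.2 u))
  have key := Finset.card_mul_eq_card_mul (s := Finset.univ) (t := Finset.univ) R
    (m := Nat.card (DecLabelling n r) * Nat.card (DecLabelling m s))
    (n := Nat.card (DecLabelling (n + m) (Sum.LiftRel r s))) ?_ ?_
  · rw [Finset.card_univ, Finset.card_univ, Fintype.card_equiv eXY, Fintype.card_prod,
      Fintype.card_perm, Fintype.card_perm, Fintype.card_sum, Fintype.card_congr eX,
      Fintype.card_congr eY, Fintype.card_fin, Fintype.card_fin] at key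
    exact key.symm
  · intro g _
    rw [Finset.bipartiteAbove, ← Fintype.card_subtype, ← Nat.card_eq_fintype_card,
      ← card_perm_comp r eX (fun x => g (.inl x)) (g.injective.comp Sum.inl_injective),
      ← card_perm_comp s eY (fun x => g (.inr x)) (g.injective.comp Sum.inr_injective),
      ← Nat.card_prod]
    exact Nat.card_congr (Equiv.subtypeProdEquivProd
      (p := fun σ : Equiv.Perm X => ∀ u v, r u v → g (.inl (σ v)) < g (.inl (σ u)))
      (q := fun τ : Equiv.Perm Y => ∀ u v, s u v → g (.inr (τ v)) < g (.inr (τ u))))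
  · rintro ⟨σ, τ⟩ _
    rw [Finset.bipartiteBelow, ← Fintype.card_subtype, ← Nat.card_eq_fintype_card]
    refine Nat.card_congr (Equiv.subtypeEquiv
      (Equiv.equivCongr (Equiv.sumCongr σ τ).symm (Equiv.refl _)) fun g => ?_)
    constructor
    · rintro ⟨h₁, h₂⟩ _ _ (⟨h⟩ | ⟨h⟩)
      · simpa using h₁ _ _ h
      · simpa using h₂ _ _ h
    · intro h
      exact ⟨fun u v huv => by simpa using h _ _ (Sum.LiftRel.inl huv),
        fun u v huv => by simpa using h _ _ (Sum.LiftRel.inr huv)⟩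

/-- The relation `r` extended by a new element related to every old one. -/
def withTop (r : X → X → Prop) : Option X → Option X → Prop
  | some u, some v => r u v
  | none, some _ => True
  | _, none => False

theorem card_withTop (r : X → X → Prop) :
    Nat.card (DecLabelling (n + 1) (withTop r)) = Nat.card (DecLabelling n r) := by
  symm
  let F : DecLabelling n r → DecLabelling (n + 1) (withTop r) := fun f =>
    ⟨f.1.optionCongr.trans finSuccEquivLast.symm, by
      rintro (_ | u) (_ | v) h
      · exact h.elim
      · simp
      · exact h.elim
      · simpa using f.2 u v h⟩
  refine Nat.card_congr (Equiv.ofBijective F ⟨?_, ?_⟩)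
  · intro f g h
    apply Subtype.ext
    ext1 x
    have := congrArg (fun k : DecLabelling (n + 1) (withTop r) => k.1 (some x)) h
    simpa [F] using this
  · rintro ⟨f, hf⟩
    have hnone : f none = Fin.last n := by
      by_contra hne
      obtain ⟨x, hx⟩ := f.surjective (Fin.last n)
      cases x with
      | none => exact hne hx
      | some x =>
        have := hf none (some x) trivial
        rw [hx] at this
        exact absurd (Fin.le_last (f none)) (not_le.2 this)
    let e : X ≃ Fin n := Equiv.removeNone (f.trans finSuccEquivLast)
    have he : e.optionCongr = f.trans finSuccEquivLast := by
      ext1 x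
      cases x with
      | none => simp [hnone]
      | some x =>
        simp only [Equiv.optionCongr_apply, Option.map_some]
        refine Equiv.removeNone_some _ (Option.ne_none_iff_exists'.1 fun h => ?_)
        have h0 : (f.trans finSuccEquivLast) none = none := by simp [hnone]
        exact absurd ((f.trans finSuccEquivLast).injective (h.trans h0.symm)) (by simp)
    have hval : ∀ x, f (some x) = (e x).castSucc := by
      intro x
      have := congrArg (fun k : Option X ≃ Option (Fin n) => finSuccEquivLast.symm (k (some x))) he
      simpa using this.symm
    refine ⟨⟨e, fun u v h => ?_⟩, Subtype.ext ?_⟩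
    · have := hf (some u) (some v) h
      rw [hval, hval] at this
      simpa using this
    · change e.optionCongr.trans finSuccEquivLast.symm = f
      rw [he]
      ext x
      simp

end DecLabelling

/-- Strict ancestry of positions. -/
def StrictPrefix (u v : List Bool) : Prop := u <+: v ∧ u ≠ v

/-- Decreasing labellings of a finite set of positions, along strict ancestry. -/
abbrev PathLabelling (S : Finset (List Bool)) : Type :=
  DecLabelling S.card (fun u v : {p // p ∈ S} => StrictPrefix u v)

/-- The proportion of labellings of a set of positions which are decreasing. -/
noncomputable def labelWeight (S : Finset (List Bool)) : ℚ :=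
  Nat.card (PathLabelling S) / S.card.factorial

theorem labelWeight_empty : labelWeight ∅ = 1 := by
  have : Nat.card (PathLabelling ∅) = 1 := by
    rw [Nat.card_eq_one_iff_unique]
    refine ⟨⟨fun f g => Subtype.ext (Equiv.ext fun x => absurd x.2 (Finset.notMem_empty _))⟩,
      ⟨⟨Finset.equivFin ∅, fun u => absurd u.2 (Finset.notMem_empty _)⟩⟩⟩
  simp [labelWeight, this]

theorem labelWeight_insert_nil {S : Finset (List Bool)} (hS : [] ∉ S) :
    labelWeight (insert [] S) = labelWeight S / (S.card + 1) := by
  have hcard : Nat.card (PathLabelling (insert [] S)) = Nat.card (PathLabelling S) := by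
    unfold PathLabelling
    rw [Finset.card_insert_of_notMem hS, 
      ← DecLabelling.card_withTop (fun u v : {p // p ∈ S} => StrictPrefix u v)]
    refine DecLabelling.card_congr (Finset.subtypeInsertEquivOption hS) ?_
    have hsymm : ∀ a b, DecLabelling.withTop (fun u v : {p // p ∈ S} => StrictPrefix u v) a b ↔
        StrictPrefix ((Finset.subtypeInsertEquivOption hS).symm a).1
          ((Finset.subtypeInsertEquivOption hS).symm b).1 := by
      rintro (_ | a) (_ | b)
      · simp [DecLabelling.withTop, Finset.subtypeInsertEquivOption, StrictPrefix]
      · have : b.1 ≠ [] := fun h => hS (h ▸ b.2)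
        simpa [DecLabelling.withTop, Finset.subtypeInsertEquivOption, StrictPrefix] using this.symm
      · simp +contextual [DecLabelling.withTop, Finset.subtypeInsertEquivOption, StrictPrefix]
      · simp [DecLabelling.withTop, Finset.subtypeInsertEquivOption]
    intro u v
    rw [hsymm]
    simp
  rw [labelWeight, labelWeight, hcard, Finset.card_insert_of_notMem hS, Nat.factorial_succ]
  push_cast
  rw [div_div, mul_comm]

/-- Positions in a node with the given positions in its left and right subtrees. -/
def graft (S T : Finset (List Bool)) : Finset (List Bool) :=
  S.map ⟨List.cons false, List.cons_injective⟩ ∪ T.map ⟨List.cons true, List.cons_injective⟩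

theorem graft_disjoint (S T : Finset (List Bool)) :
    Disjoint (S.map ⟨List.cons false, List.cons_injective⟩)
      (T.map ⟨List.cons true, List.cons_injective⟩) := by
  simp [Finset.disjoint_left]

theorem card_graft (S T : Finset (List Bool)) : (graft S T).card = S.card + T.card := by
  rw [graft, Finset.card_union_of_disjoint (graft_disjoint S T), Finset.card_map, Finset.card_map]

theorem cons_false_mem_graft {S T : Finset (List Bool)} {p : List Bool} :
    false :: p ∈ graft S T ↔ p ∈ S := by
  simp [graft]

theorem cons_true_mem_graft {S T : Finset (List Bool)} {p : List Bool} :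
    true :: p ∈ graft S T ↔ p ∈ T := by
  simp [graft]

theorem nil_notMem_graft {S T : Finset (List Bool)} : [] ∉ graft S T := by
  simp [graft]

theorem labelWeight_graft (S T : Finset (List Bool)) :
    labelWeight (graft S T) = labelWeight S * labelWeight T := by
  let F : {p // p ∈ S} ⊕ {p // p ∈ T} → {p // p ∈ graft S T} :=
    Sum.elim (fun p => ⟨false :: p.1, cons_false_mem_graft.2 p.2⟩)
      (fun p => ⟨true :: p.1, cons_true_mem_graft.2 p.2⟩)
  have hF : Function.Bijective F := by
    constructor
    · rintro (a | a) (b | b) h <;>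
        simpa [F, Subtype.coe_inj] using congrArg Subtype.val h
    · rintro ⟨p, hp⟩
      rcases p with _ | ⟨_ | _, p⟩
      · exact absurd hp nil_notMem_graft
      · exact ⟨.inl ⟨p, cons_false_mem_graft.1 hp⟩, rfl⟩
      · exact ⟨.inr ⟨p, cons_true_mem_graft.1 hp⟩, rfl⟩
  have hcard : Nat.card (PathLabelling (graft S T)) =
      Nat.card (DecLabelling (S.card + T.card) (Sum.LiftRel
        (fun u v : {p // p ∈ S} => StrictPrefix u v)
        (fun u v : {p // p ∈ T} => StrictPrefix u v))) := by
    unfold PathLabelling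
    rw [card_graft]
    refine (DecLabelling.card_congr (Equiv.ofBijective F hF) ?_).symm
    rintro (a | a) (b | b) <;> simp [F, StrictPrefix]
  have key := DecLabelling.card_sum (fun u v : {p // p ∈ S} => StrictPrefix u v)
    (fun u v : {p // p ∈ T} => StrictPrefix u v) S.equivFin T.equivFin
  rw [labelWeight, labelWeight, labelWeight, hcard, card_graft, div_mul_div_comm,
    div_eq_div_iff (by positivity) (by positivity)]
  norm_cast
  rw [mul_comm, key, mul_comm]

namespace BT

/-- The children on side `d`. -/
def children (d : Bool) (B : BT) : Finset (List Bool) :=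
  B.paths.toFinset.filter (fun p => p.getLast? = some d)

/-- The vertices of `B` which are children on side `d` once `B` is attached on side `c`
of a new vertex. -/
def childrenBelow (d c : Bool) (B : BT) : Finset (List Bool) :=
  B.paths.toFinset.filter (fun p => (c :: p).getLast? = some d)

theorem children_node (d : Bool) (l r : BT) :
    (node l r).children d = graft (l.childrenBelow d false) (r.childrenBelow d true) := by
  ext p
  rcases p with _ | ⟨_ | _, p⟩
  · simp [children, nil_notMem_graft]
  · simp [children, childrenBelow, cons_false_mem_graft, paths]
  · simp [children, childrenBelow, cons_true_mem_graft, paths]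

theorem childrenBelow_of_ne {d c : Bool} (h : c ≠ d) (B : BT) :
    B.childrenBelow d c = B.children d := by
  ext p
  rcases p with _ | ⟨b, p⟩ <;> simp [children, childrenBelow, h]

theorem nil_notMem_children (d : Bool) (B : BT) : [] ∉ B.children d := by
  simp [children]

theorem childrenBelow_self {d : Bool} {B : BT} (h : B ≠ nil) :
    B.childrenBelow d d = insert [] (B.children d) := by
  cases B with
  | nil => exact absurd rfl h
  | node l r =>
    ext p
    rcases p with _ | ⟨b, p⟩ <;> simp [children, childrenBelow, paths]

theorem childrenBelow_nil (d c : Bool) : nil.childrenBelow d c = ∅ := rfl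

end BT

/-- A non-ambiguous tree is a pair of decreasing labellings. -/
noncomputable def NAT.equivProd (B : BT) :
    NAT B ≃ PathLabelling (B.children false) × PathLabelling (B.children true) where
  toFun N := (⟨Equiv.ofBijective N.fL N.bijL, fun u v h =>
      N.ancL u v h.1 fun e => h.2 (congrArg Subtype.val e)⟩,
    ⟨Equiv.ofBijective N.fR N.bijR, fun u v h =>
      N.ancR u v h.1 fun e => h.2 (congrArg Subtype.val e)⟩)
  invFun p :=
    { fL := p.1.1
      fR := p.2.1
      bijL := p.1.1.bijective
      bijR := p.2.1.bijective
      ancL := fun u v h hne => p.1.2 u v ⟨h, fun e => hne (Subtype.ext e)⟩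
      ancR := fun u v h hne => p.2.2 u v ⟨h, fun e => hne (Subtype.ext e)⟩ }
  left_inv _ := rfl
  right_inv _ := Prod.ext (Subtype.ext (Equiv.ext fun _ => rfl))
    (Subtype.ext (Equiv.ext fun _ => rfl))

instance inst_s3 (B : BT) : Finite (NAT B) := Finite.of_equiv _ (NAT.equivProd B).symm

theorem NAT.card_div_factorial (B : BT) :
    (Nat.card (NAT B) : ℚ) /
        ((B.children false).card.factorial * (B.children true).card.factorial) =
      labelWeight (B.children false) * labelWeight (B.children true) := by
  rw [Nat.card_congr (NAT.equivProd B), Nat.card_prod, labelWeight, labelWeight,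
    div_mul_div_comm]
  push_cast
  rfl

namespace BT

/-- The binary trees of height at most `k`. -/
def ofHeightLE : ℕ → Finset BT
  | 0 => {nil}
  | k + 1 => insert nil ((ofHeightLE k ×ˢ ofHeightLE k).image fun p => node p.1 p.2)

theorem nil_mem_ofHeightLE (k : ℕ) : nil ∈ ofHeightLE k := by
  cases k <;> simp [ofHeightLE]

theorem node_mem_ofHeightLE {k : ℕ} {l r : BT} :
    node l r ∈ ofHeightLE (k + 1) ↔ l ∈ ofHeightLE k ∧ r ∈ ofHeightLE k := by
  simp [ofHeightLE]

theorem ofHeightLE_mono : Monotone ofHeightLE := by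
  refine monotone_nat_of_le_succ fun k => ?_
  induction k with
  | zero => simp [ofHeightLE]
  | succ k ih =>
    intro B hB
    cases B with
    | nil => exact nil_mem_ofHeightLE _
    | node l r =>
      rw [node_mem_ofHeightLE] at hB ⊢
      exact ⟨ih hB.1, ih hB.2⟩

theorem card_childrenBelow_self {d : Bool} {B : BT} (h : B ≠ nil) :
    (B.childrenBelow d d).card = (B.children d).card + 1 := by
  rw [childrenBelow_self h, Finset.card_insert_of_notMem (nil_notMem_children d B)]

theorem mem_ofHeightLE (B : BT) :
    B ∈ ofHeightLE ((B.children false).card + (B.children true).card + 1) := by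
  induction B with
  | nil => exact nil_mem_ofHeightLE _
  | node l r ihl ihr =>
    rw [node_mem_ofHeightLE]
    simp only [children_node, card_graft, childrenBelow_of_ne (show false ≠ true by decide),
      childrenBelow_of_ne (show true ≠ false by decide)]
    constructor
    · by_cases h : l = nil
      · exact h ▸ nil_mem_ofHeightLE _
      · refine ofHeightLE_mono ?_ ihl
        rw [card_childrenBelow_self h]
        omega
    · by_cases h : r = nil
      · exact h ▸ nil_mem_ofHeightLE _
      · refine ofHeightLE_mono ?_ ihr
        rw [card_childrenBelow_self h]
        omega

end BT

open MvPowerSeries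

/-- The Euler operator `xᵢ ∂/∂xᵢ` on power series. -/
noncomputable def euler (i : Fin 2) : MvPowerSeries (Fin 2) ℚ →ₗ[ℚ] MvPowerSeries (Fin 2) ℚ where
  toFun f := fun e => (e i : ℚ) * coeff e f
  map_add' f g := by
    ext e
    exact mul_add _ _ _
  map_smul' c f := by
    ext e
    exact mul_left_comm _ _ _

theorem coeff_euler (i : Fin 2) (f : MvPowerSeries (Fin 2) ℚ) (e : Fin 2 →₀ ℕ) :
    coeff e (euler i f) = (e i : ℚ) * coeff e f := rfl

theorem euler_mul (i : Fin 2) (f g : MvPowerSeries (Fin 2) ℚ) :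
    euler i (f * g) = euler i f * g + f * euler i g := by
  ext e
  rw [coeff_euler, map_add, coeff_mul, coeff_mul, coeff_mul, Finset.mul_sum,
    ← Finset.sum_add_distrib]
  refine Finset.sum_congr rfl fun p hp => ?_
  rw [Finset.HasAntidiagonal.mem_antidiagonal] at hp
  rw [coeff_euler, coeff_euler, ← hp, Finsupp.add_apply]
  push_cast
  ring

theorem euler_one (i : Fin 2) : euler i 1 = 0 := by
  ext e
  rw [coeff_euler, coeff_one]
  split_ifs with h <;> simp [h]

theorem euler_monomial (i : Fin 2) (e : Fin 2 →₀ ℕ) (c : ℚ) :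
    euler i (monomial e c) = monomial e (e i * c) := by
  ext e'
  rw [coeff_euler, coeff_monomial, coeff_monomial]
  split_ifs with h <;> simp [h]

/-- Two power series agree in total degree less than `d`. -/
def AgreeBelow (d : ℕ) (f g : MvPowerSeries (Fin 2) ℚ) : Prop :=
  ∀ e : Fin 2 →₀ ℕ, e 0 + e 1 < d → coeff e f = coeff e g

namespace AgreeBelow

variable {d : ℕ} {f g f' g' : MvPowerSeries (Fin 2) ℚ}

theorem mul (h : AgreeBelow d f g) (h' : AgreeBelow d f' g') :
    AgreeBelow d (f * f') (g * g') := by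
  intro e he
  rw [coeff_mul, coeff_mul]
  refine Finset.sum_congr rfl fun p hp => ?_
  rw [Finset.HasAntidiagonal.mem_antidiagonal] at hp
  rw [← hp, Finsupp.add_apply, Finsupp.add_apply] at he
  rw [h p.1 (by omega), h' p.2 (by omega)]

theorem X_mul (h : AgreeBelow d f g) (i : Fin 2) : AgreeBelow (d + 1) (X i * f) (X i * g) := by
  intro e he
  rw [coeff_mul, coeff_mul]
  refine Finset.sum_congr rfl fun p hp => ?_
  rw [Finset.HasAntidiagonal.mem_antidiagonal] at hp
  rw [coeff_X]
  split_ifs with h1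
  · rw [h]
    rw [← hp, h1, Finsupp.add_apply, Finsupp.add_apply] at he
    fin_cases i <;> simp at he <;> omega
  · simp

theorem of_euler (i : Fin 2) (h₀ : ∀ e : Fin 2 →₀ ℕ, e i = 0 → coeff e f = coeff e g)
    (h : AgreeBelow d (euler i f) (euler i g)) : AgreeBelow d f g := by
  intro e he
  by_cases hi : e i = 0
  · exact h₀ e hi
  · exact mul_left_cancel₀ (Nat.cast_ne_zero.2 hi) (h e he)

end AgreeBelow

theorem coeff_expXY (a b : ℚ) (e : Fin 2 →₀ ℕ) :
    coeff e (expXY a b) = a ^ (e 0) * b ^ (e 1) / ((e 0).factorial * (e 1).factorial) := rfl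

theorem expXY_one_one : expXY 1 1 = expXY 1 0 * expXY 0 1 := by
  ext e
  rw [coeff_mul, Finset.sum_eq_single (Finsupp.single 0 (e 0), Finsupp.single 1 (e 1))]
  · simp [coeff_expXY, mul_comm]
  · rintro ⟨p, q⟩ hpq hne
    rw [Finset.HasAntidiagonal.mem_antidiagonal] at hpq
    by_cases hp : p 1 = 0
    · by_cases hq : q 0 = 0
      · refine absurd ?_ hne
        simp only at hpq
        subst hpq
        ext j <;> fin_cases j <;> simp [hp, hq]
      · simp [coeff_expXY, hq]
    · simp [coeff_expXY, hp]
  · intro h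
    refine absurd (Finset.HasAntidiagonal.mem_antidiagonal.2 ?_) h
    ext j
    fin_cases j <;> simp

theorem coeff_X_mul_succ (i : Fin 2) (f : MvPowerSeries (Fin 2) ℚ) (e : Fin 2 →₀ ℕ) :
    coeff (Finsupp.single i 1 + e) (X i * f) = coeff e f := by
  rw [X, coeff_add_monomial_mul, one_mul]

theorem coeff_mul_eq_zero_of_left (i : Fin 2) {f : MvPowerSeries (Fin 2) ℚ}
    (hf : ∀ e : Fin 2 →₀ ℕ, e i = 0 → coeff e f = 0) (g : MvPowerSeries (Fin 2) ℚ)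
    (e : Fin 2 →₀ ℕ) (he : e i = 0) : coeff e (f * g) = 0 := by
  rw [coeff_mul]
  refine Finset.sum_eq_zero fun p hp => ?_
  rw [Finset.HasAntidiagonal.mem_antidiagonal] at hp
  rw [← hp, Finsupp.add_apply] at he
  rw [hf p.1 (by omega), zero_mul]

theorem coeff_X_mul_eq_zero (i : Fin 2) (f : MvPowerSeries (Fin 2) ℚ)
    (e : Fin 2 →₀ ℕ) (he : e i = 0) : coeff e (X i * f) = 0 := by
  refine coeff_mul_eq_zero_of_left i (fun e he => ?_) f e he
  rw [coeff_X, if_neg]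
  rintro rfl
  simp at he

/-- The exponential series in the single variable `i`. -/
noncomputable def expVar (i : Fin 2) : MvPowerSeries (Fin 2) ℚ :=
  if i = 0 then expXY 1 0 else expXY 0 1

theorem coeff_expVar (i : Fin 2) (e : Fin 2 →₀ ℕ) :
    coeff e (expVar i) = if e (1 - i) = 0 then 1 / ((e i).factorial : ℚ) else 0 := by
  fin_cases i
  · by_cases h : e 1 = 0 <;> simp [expVar, coeff_expXY, h]
  · by_cases h : e 0 = 0 <;> simp [expVar, coeff_expXY, h]

theorem euler_expVar (i : Fin 2) : euler i (expVar i) = X i * expVar i := by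
  ext e
  have hi : 1 - i ≠ i := by fin_cases i <;> decide
  rw [coeff_euler]
  by_cases he : e i = 0
  · rw [coeff_X_mul_eq_zero i _ e he, he, Nat.cast_zero, zero_mul]
  · obtain ⟨e', rfl⟩ : ∃ e', e = Finsupp.single i 1 + e' :=
      ⟨e - Finsupp.single i 1, (add_tsub_cancel_of_le
        (Finsupp.single_le_iff.2 (Nat.one_le_iff_ne_zero.2 he))).symm⟩
    rw [coeff_X_mul_succ, coeff_expVar, coeff_expVar]
    simp only [Finsupp.add_apply, Finsupp.single_eq_same, Finsupp.single_eq_of_ne hi, zero_add,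
      add_comm 1, Nat.factorial_succ]
    split_ifs
    · push_cast
      field_simp
    · simp

theorem euler_expVar_of_ne (i : Fin 2) : euler i (expVar (1 - i)) = 0 := by
  ext e
  rw [coeff_euler, coeff_expVar, sub_sub_cancel]
  split_ifs with h <;> simp [h]

theorem coeff_expVar_sub_one (i : Fin 2) (e : Fin 2 →₀ ℕ) (he : e i = 0) :
    coeff e (expVar i - 1) = 0 := by
  rw [map_sub, coeff_expVar, coeff_one]
  have : e = 0 ↔ e (1 - i) = 0 := by
    constructor
    · rintro rfl
      rfl
    · intro h
      ext j
      fin_cases i <;> fin_cases j <;> assumption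
  simp [this, he]

/-- If `I` is the inverse of `1 - (e^x - 1)(e^y - 1)`, then `∂/∂x (e^x I) = e^x e^y I²`, and
symmetrically in the other variable. -/
theorem euler_expVar_mul {I : MvPowerSeries (Fin 2) ℚ} (i : Fin 2)
    (hI : (1 - (expVar i - 1) * (expVar (1 - i) - 1)) * I = 1) :
    euler i (expVar i * I) = X i * (expVar i * expVar (1 - i) * I ^ 2) := by
  have h := congrArg (euler i) hI
  simp only [euler_mul, map_sub, euler_one, euler_expVar, euler_expVar_of_ne] at h
  rw [euler_mul, euler_expVar]
  linear_combination (expVar i * I) * h + (-(X i * expVar i * I) - expVar i * euler i I) * hI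

theorem coeff_expVar_mul {I : MvPowerSeries (Fin 2) ℚ} (i : Fin 2)
    (hI : (1 - (expVar i - 1) * (expVar (1 - i) - 1)) * I = 1) (e : Fin 2 →₀ ℕ) (he : e i = 0) :
    coeff e (expVar i * I) = coeff e 1 := by
  have h : expVar i * I = 1 + (expVar i - 1) * (expVar (1 - i) * I) := by
    linear_combination hI
  rw [h, map_add, coeff_mul_eq_zero_of_left i (coeff_expVar_sub_one i) _ e he, add_zero]

/-- The exponent of `x^a y^b`. -/
noncomputable def bidegree (a b : ℕ) : Fin 2 →₀ ℕ := Finsupp.single 0 a + Finsupp.single 1 b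

theorem bidegree_zero (a b : ℕ) : bidegree a b 0 = a := by simp [bidegree]

theorem bidegree_one (a b : ℕ) : bidegree a b 1 = b := by simp [bidegree]

theorem eq_bidegree_iff {a b : ℕ} {e : Fin 2 →₀ ℕ} :
    e = bidegree a b ↔ a = e 0 ∧ b = e 1 := by
  constructor
  · rintro rfl
    exact ⟨(bidegree_zero a b).symm, (bidegree_one a b).symm⟩
  · rintro ⟨rfl, rfl⟩
    ext j
    fin_cases j <;> simp [bidegree]

theorem bidegree_add (a b a' b' : ℕ) :
    bidegree (a + a') (b + b') = bidegree a b + bidegree a' b' := by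
  ext j
  fin_cases j <;> simp [bidegree]

/-- The monomial of a pair of sets of positions, weighted by their label weights. -/
noncomputable def labelMonomial (S T : Finset (List Bool)) : MvPowerSeries (Fin 2) ℚ :=
  monomial (bidegree S.card T.card) (labelWeight S * labelWeight T)

theorem labelMonomial_graft (S S' T T' : Finset (List Bool)) :
    labelMonomial (graft S S') (graft T T') = labelMonomial S T * labelMonomial S' T' := by
  simp only [labelMonomial, card_graft, labelWeight_graft, bidegree_add, monomial_mul_monomial]
  congr 1
  ring

namespace BT

/-- The contribution of the trees of shape `B` to the generating series. -/
noncomputable def term (B : BT) : MvPowerSeries (Fin 2) ℚ :=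
  labelMonomial (B.children false) (B.children true)

/-- The contribution of the trees of shape `B` as the subtree on side `c` of a vertex. -/
noncomputable def termBelow (c : Bool) (B : BT) : MvPowerSeries (Fin 2) ℚ :=
  labelMonomial (B.childrenBelow false c) (B.childrenBelow true c)

theorem term_node (l r : BT) : (node l r).term = l.termBelow false * r.termBelow true := by
  rw [term, children_node, children_node, labelMonomial_graft, termBelow, termBelow]

theorem termBelow_nil (c : Bool) : nil.termBelow c = 1 := by
  simp [termBelow, childrenBelow_nil, labelMonomial, labelWeight_empty, bidegree,
    monomial_zero_one]

theorem labelWeight_childrenBelow_self {d : Bool} {B : BT} (h : B ≠ nil) :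
    ((B.children d).card + 1) * labelWeight (B.childrenBelow d d) = labelWeight (B.children d) := by
  rw [childrenBelow_self h, labelWeight_insert_nil (nil_notMem_children d B)]
  exact mul_div_cancel₀ _ (Nat.cast_add_one_ne_zero _)

theorem euler_termBelow_false {B : BT} (h : B ≠ nil) :
    euler 0 (B.termBelow false) = X 0 * B.term := by
  rw [termBelow, labelMonomial, euler_monomial, term, labelMonomial, X, monomial_mul_monomial,
    bidegree_zero, card_childrenBelow_self h, childrenBelow_of_ne (show false ≠ true by decide),
    ← labelWeight_childrenBelow_self (d := false) h]
  congr 1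
  · rw [add_comm (Finset.card _), ← zero_add (Finset.card (B.children true)), bidegree_add]
    simp [bidegree]
  · push_cast
    ring

theorem euler_termBelow_true {B : BT} (h : B ≠ nil) :
    euler 1 (B.termBelow true) = X 1 * B.term := by
  rw [termBelow, labelMonomial, euler_monomial, term, labelMonomial, X, monomial_mul_monomial,
    bidegree_one, card_childrenBelow_self h, childrenBelow_of_ne (show true ≠ false by decide),
    ← labelWeight_childrenBelow_self (d := true) h]
  congr 1
  · rw [add_comm (Finset.card _), ← zero_add (Finset.card (B.children false)), bidegree_add]
    simp [bidegree]
  · push_cast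
    ring

/-- The generating series of the trees whose shape is nonempty of height at most `k`. -/
noncomputable def truncGF (k : ℕ) : MvPowerSeries (Fin 2) ℚ :=
  ∑ B ∈ (ofHeightLE k).erase nil, B.term

/-- The generating series of the trees of height at most `k` as subtrees on side `c`. -/
noncomputable def truncBelow (c : Bool) (k : ℕ) : MvPowerSeries (Fin 2) ℚ :=
  ∑ B ∈ ofHeightLE k, B.termBelow c

theorem truncGF_succ (k : ℕ) :
    truncGF (k + 1) = truncBelow false k * truncBelow true k := by
  rw [truncGF, truncBelow, truncBelow, Finset.sum_mul_sum, ← Finset.sum_product', ofHeightLE,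
    Finset.erase_insert (by simp), Finset.sum_image]
  · exact Finset.sum_congr rfl fun p _ => term_node p.1 p.2
  · rintro ⟨l, r⟩ _ ⟨l', r'⟩ _ h
    simpa using h

theorem truncBelow_eq (c : Bool) (k : ℕ) :
    truncBelow c k = 1 + ∑ B ∈ (ofHeightLE k).erase nil, B.termBelow c := by
  rw [truncBelow, ← Finset.add_sum_erase _ _ (nil_mem_ofHeightLE k), termBelow_nil]

theorem euler_truncBelow {c : Bool} {i : Fin 2}
    (h : ∀ B : BT, B ≠ nil → euler i (B.termBelow c) = X i * B.term) (k : ℕ) :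
    euler i (truncBelow c k) = X i * truncGF k := by
  rw [truncBelow_eq, map_add, euler_one, zero_add, map_sum, truncGF, Finset.mul_sum]
  exact Finset.sum_congr rfl fun B hB => h B (Finset.ne_of_mem_erase hB)

theorem coeff_truncBelow {c : Bool} {i : Fin 2} (k : ℕ)
    (hc : ∀ B : BT, B ≠ nil → (bidegree (B.childrenBelow false c).card
      (B.childrenBelow true c).card) i ≠ 0)
    (e : Fin 2 →₀ ℕ) (he : e i = 0) : coeff e (truncBelow c k) = coeff e 1 := by
  rw [truncBelow_eq, map_add, map_sum, Finset.sum_eq_zero, add_zero]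
  intro B hB
  rw [termBelow, labelMonomial, coeff_monomial, if_neg]
  rintro rfl
  exact hc B (Finset.ne_of_mem_erase hB) he

theorem coeff_truncGF (k : ℕ) (e : Fin 2 →₀ ℕ) (hk : e 0 + e 1 < k) :
    coeff e (truncGF k) = coeff e natGF := by
  let s : Finset BT := ((ofHeightLE k).erase nil).filter
    fun B => (B.children false).card = e 0 ∧ (B.children true).card = e 1
  have hs : ∀ B, B ∈ s ↔
      B ≠ nil ∧ (B.children false).card = e 0 ∧ (B.children true).card = e 1 := by
    intro B
    simp only [s, Finset.mem_filter, Finset.mem_erase]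
    constructor
    · exact fun h => ⟨h.1.1, h.2⟩
    · rintro ⟨h, h₀, h₁⟩
      exact ⟨⟨h, ofHeightLE_mono (by omega) (mem_ofHeightLE B)⟩, h₀, h₁⟩
  have hcount : natCount (e 0) (e 1) = ∑ B ∈ s, Nat.card (NAT B) := by
    rw [natCount, ← Finset.sum_coe_sort s, ← Nat.card_sigma]
    refine Nat.card_congr ((Equiv.subtypeSigmaEquiv NAT fun B => B ≠ nil ∧
      B.leftVertices.card = e 0 ∧ B.rightVertices.card = e 1).trans
      (Equiv.sigmaCongrLeft (β := fun B : {B // B ∈ s} => NAT B.1)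
        (Equiv.subtypeEquivRight fun B => (hs B).symm)))
  have hN : coeff e natGF = (natCount (e 0) (e 1) : ℚ) / ((e 0).factorial * (e 1).factorial) := rfl
  rw [hN, hcount, truncGF, map_sum, Nat.cast_sum, Finset.sum_div, Finset.sum_filter]
  refine Finset.sum_congr rfl fun B _ => ?_
  simp only [term, labelMonomial, coeff_monomial, eq_bidegree_iff]
  split_ifs with h
  · rw [← NAT.card_div_factorial, h.1, h.2]
  · rfl

theorem agreeBelow_truncGF {I : MvPowerSeries (Fin 2) ℚ}
    (hI : (1 - (expVar 0 - 1) * (expVar 1 - 1)) * I = 1) (k : ℕ) :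
    AgreeBelow k (truncGF k) (expVar 0 * expVar 1 * I ^ 2) := by
  induction k with
  | zero => exact fun e he => absurd he (Nat.not_lt_zero _)
  | succ k ih =>
    have hI' : (1 - (expVar 1 - 1) * (expVar 0 - 1)) * I = 1 := by
      rw [mul_comm (expVar 1 - 1), hI]
    have hl : AgreeBelow (k + 1) (truncBelow false k) (expVar 0 * I) := by
      refine .of_euler 0 (fun e he => ?_) ?_
      · rw [coeff_expVar_mul 0 hI e he]
        refine coeff_truncBelow k (fun B hB => ?_) e he
        rw [bidegree_zero, card_childrenBelow_self hB]
        exact Nat.succ_ne_zero _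
      · rw [euler_truncBelow (fun B => euler_termBelow_false), euler_expVar_mul 0 hI]
        exact ih.X_mul 0
    have hr : AgreeBelow (k + 1) (truncBelow true k) (expVar 1 * I) := by
      refine .of_euler 1 (fun e he => ?_) ?_
      · rw [coeff_expVar_mul 1 hI' e he]
        refine coeff_truncBelow k (fun B hB => ?_) e he
        rw [bidegree_one, card_childrenBelow_self hB]
        exact Nat.succ_ne_zero _
      · rw [euler_truncBelow (fun B => euler_termBelow_true), euler_expVar_mul 1 hI']
        have := ih.X_mul 1
        rwa [mul_comm (expVar 0)] at this
    rw [truncGF_succ]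
    have := hl.mul hr
    rwa [show expVar 0 * I * (expVar 1 * I) = expVar 0 * expVar 1 * I ^ 2 by ring] at this

end BT

/-- `N · (1 − (eˣ−1)(e^y−1))² = e^{x+y}`. -/
theorem natGF_closed_form :
    natGF * (1 - (expXY 1 0 - 1) * (expXY 0 1 - 1)) ^ 2 = expXY 1 1 := by
  have h₀ : expXY 1 0 = expVar 0 := rfl
  have h₁ : expXY 0 1 = expVar 1 := rfl
  rw [expXY_one_one, h₀, h₁]
  obtain ⟨I, hI⟩ : ∃ I, (1 - (expVar 0 - 1) * (expVar 1 - 1)) * I = 1 := by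
    refine ⟨_, MvPowerSeries.mul_inv_cancel _ ?_⟩
    have : constantCoeff (expVar 0 - 1) = 0 := coeff_expVar_sub_one 0 0 rfl
    simp [this]
  have hN : natGF = expVar 0 * expVar 1 * I ^ 2 := by
    ext e
    rw [← BT.coeff_truncGF _ e (Nat.lt_succ_self _)]
    exact BT.agreeBelow_truncGF hI _ e (Nat.lt_succ_self _)
  rw [hN, mul_assoc, ← mul_pow, mul_comm I, hI, one_pow, mul_one]
end
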